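/- Let U be a finite set of fingerprints of length l, let s be a resolvable subset of U of maximum cardinality among all resolvable subsets of U, and let Opt be a partition of U into resolvable parts. For x ∈ U, let C(x) = {y ∈ U : y ≠ x and y is compatible with x} and let D(x) = {y ∈ C(x) : y is not in the same part of Opt as x}. Then for every x ∈ U, |D(x)| ≥ |C(x)| − |s| + 1. -/

import Mathlib

open scoped Classical

abbrev Fingerprint (l : ℕ) := Fin l → Option Bool

/-- Two fingerprints are compatible if at every position they agree or one is unknown. -/
def Compatible {l : ℕ} (v₁ v₂ : Fingerprint l) : Prop :=
  ∀ i, v₁ i = v₂ i ∨ v₁ i = none ∨ v₂ i = none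

/-- `r` is a resolution of the fingerprint `v`. -/
def IsResolution {l : ℕ} (r : Fin l → Bool) (v : Fingerprint l) : Prop :=
  ∀ i b, v i = some b → r i = b

/-- A finite set of fingerprints is resolvable if a single resolved vector resolves all. -/
def Resolvable {l : ℕ} (t : Finset (Fingerprint l)) : Prop :=
  ∃ r : Fin l → Bool, ∀ v ∈ t, IsResolution r v

/-- With `sM` a maximum-cardinality resolvable subset of `U` and `Opt` a partition of `U`
into resolvable parts: for `x ∈ U`, letting `C x` be the fingerprints of `U` (other
than `x`) compatible with `x` and `D x ⊆ C x` those not in the same part of `Opt`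
as `x`, we have `|D x| ≥ |C x| - |sM| + 1`. -/
theorem D_card_ge {l : ℕ} (U sM : Finset (Fingerprint l)) (hsub : sM ⊆ U)
    (hres : Resolvable sM) (hmax : ∀ t ⊆ U, Resolvable t → t.card ≤ sM.card)
    (Opt : Finpartition U) (hOpt : ∀ t ∈ Opt.parts, Resolvable t) :
    ∀ x ∈ U,
      (((U.filter (fun y => y ≠ x ∧ Compatible x y)).filter
            (fun y => ∀ t ∈ Opt.parts, ¬(x ∈ t ∧ y ∈ t))).card : ℤ)
        ≥ ((U.filter (fun y => y ≠ x ∧ Compatible x y)).card : ℤ) - (sM.card : ℤ) + 1 := by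
  intro x hx
  obtain ⟨t, ht, hxt⟩ := Opt.exists_mem hx
  have h1 := hmax t (Opt.le ht) (hOpt t ht)
  have h2 := Finset.card_filter_add_card_filter_not
    (s := U.filter (fun y => y ≠ x ∧ Compatible x y))
    (fun y => ∀ t ∈ Opt.parts, ¬(x ∈ t ∧ y ∈ t))
  have h3 : ((U.filter (fun y => y ≠ x ∧ Compatible x y)).filter
      (fun y => ¬ ∀ t ∈ Opt.parts, ¬(x ∈ t ∧ y ∈ t))).card ≤ (t.erase x).card := by
    apply Finset.card_le_card
    intro y hy
    rw [Finset.mem_filter, Finset.mem_filter] at hy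
    obtain ⟨⟨_, hne, _⟩, hy⟩ := hy
    push Not at hy
    obtain ⟨t', ht', hxt', hyt'⟩ := hy
    have h : t' = t := Opt.eq_of_mem_parts ht' ht hxt' hxt
    subst h
    exact Finset.mem_erase.2 ⟨hne, hyt'⟩
  have h4 := Finset.card_erase_add_one hxt
  omega
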